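/- (Theorem 3.1, part 2) Under the Async-PADMM update rules, suppose each g_k is continuously differentiable, f(x) := Σ_{k=1}^K g_k(x) + h(x) is bounded from below on X, h is continuous, and the stepsizes satisfy Assumption A3: for every k, ρ_k > 7L_k and α_k := ρ_k − 2(1/ρ_k + 7L_k/(2ρ_k²)) L_k²(T_k+1)² − L_k T_k² > 0. If (x*, {x_k*}, {y_k*}) is a limit point of the sequence (x^t, {x_k^t}, {y_k^t}) (i.e. the limit along some subsequence t_j → ∞), then x_k* = x* for every k, y_k* = −∇g_k(x*) for every k, and x* is a stationary point of the problem min_{x∈X} f(x): for all u ∈ X, ⟨Σ_{k=1}^K ∇g_k(x*), u − x*⟩ + h(u) − h(x*) ≥ 0. -/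

import Mathlib

open RealInnerProductSpace Filter Topology

/-- The augmented Lagrangian of the consensus problem. -/
noncomputable def augL {E : Type*} [NormedAddCommGroup E] [InnerProductSpace ℝ E]
    {K : ℕ} (g : Fin K → E → ℝ) (h : E → ℝ) (ρ : Fin K → ℝ)
    (xk : Fin K → E) (x : E) (y : Fin K → E) : ℝ :=
  (∑ k, g k (xk k)) + h x + (∑ k, ⟪y k, xk k - x⟫) + ∑ k, ρ k / 2 * ‖xk k - x‖ ^ 2

theorem aux_descent {E : Type*} [NormedAddCommGroup E] [InnerProductSpace ℝ E] [CompleteSpace E]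
    (g : E → ℝ) (L : ℝ) (hL : 0 < L) (hg : ContDiff ℝ 1 g)
    (hlip : ∀ u v : E, ‖gradient g u - gradient g v‖ ≤ L * ‖u - v‖) (u v : E) :
    |g v - g u - ⟪gradient g u, v - u⟫| ≤ L * ‖v - u‖ ^ 2 := by
  have hd : Differentiable ℝ g := hg.differentiable (by norm_num)
  have key := Convex.norm_image_sub_le_of_norm_fderiv_le' (𝕜 := ℝ) (f := g)
    (φ := InnerProductSpace.toDual ℝ E (gradient g u)) (C := L * ‖v - u‖)
    (s := Metric.closedBall u ‖v - u‖) (x := u) (y := v)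
    (fun x _ => hd x) (by
      intro w hw
      rw [← toDual_gradient, ← map_sub, LinearIsometryEquiv.norm_map]
      refine (hlip w u).trans ?_
      rw [mem_closedBall_iff_norm] at hw
      gcongr) (convex_closedBall _ _) (by simp) (by simp [dist_eq_norm])
  rw [Real.norm_eq_abs, InnerProductSpace.toDual_apply_apply] at key
  calc _ ≤ _ := key
    _ = _ := by ring

theorem aux_kstep {E : Type*} [NormedAddCommGroup E] [InnerProductSpace ℝ E] [CompleteSpace E]
    (g : E → ℝ) (L ρ : ℝ) (hL : 0 < L) (hρ : 7 * L < ρ) (hg : ContDiff ℝ 1 g)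
    (hlip : ∀ u v : E, ‖gradient g u - gradient g v‖ ≤ L * ‖u - v‖)
    (p q z w y y' : E) (h1 : y' = y + ρ • (p - z)) (h2 : y' = - gradient g w) :
    (g p + ⟪y', p - z⟫ + ρ / 2 * ‖p - z‖ ^ 2) - (g q + ⟪y, q - z⟫ + ρ / 2 * ‖q - z‖ ^ 2)
      ≤ (ρ + L / 2) * ‖p - z‖ ^ 2 + L / 2 * ‖z - w‖ ^ 2 := by
  obtain ⟨a, ha⟩ : ∃ a, a = p - z := ⟨_, rfl⟩
  obtain ⟨c, hc⟩ : ∃ c, c = p - q := ⟨_, rfl⟩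
  have hqz : q - z = a - c := by rw [ha, hc]; abel
  have hqp : q - p = - c := by rw [hc]; abel
  have hD := (abs_le.1 (aux_descent g L hL hg hlip p q)).1
  have hyc : y = y' - ρ • a := by rw [h1, ha]; abel
  have hsq : ‖a - c‖ ^ 2 = ‖a‖ ^ 2 - 2 * ⟪a, c⟫ + ‖c‖ ^ 2 := norm_sub_sq_real a c
  have e1 : ⟪y, a - c⟫ = ⟪y', a⟫ - ⟪y', c⟫ - ρ * ‖a‖ ^ 2 + ρ * ⟪a, c⟫ := by
    rw [hyc, inner_sub_left, inner_sub_right, inner_sub_right, real_inner_smul_left,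
      real_inner_smul_left, real_inner_self_eq_norm_sq]; ring
  rw [← ha, hqz, hsq, e1]
  rw [hqp, inner_neg_right, norm_neg] at hD
  have e2 : ⟪gradient g p, c⟫ + ⟪y', c⟫ ≤ L * (‖a‖ + ‖z - w‖) * ‖c‖ := by
    rw [← inner_add_left, h2, ← sub_eq_add_neg]
    refine (real_inner_le_norm _ _).trans ?_
    gcongr
    refine (hlip _ _).trans ?_
    gcongr
    have : p - w = a + (z - w) := by rw [ha]; abel
    rw [this]; exact norm_add_le _ _
  have := norm_nonneg a
  have := norm_nonneg c
  have := norm_nonneg (z - w)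
  nlinarith [mul_nonneg hL.le (sq_nonneg (‖a‖ - ‖c‖)), mul_nonneg hL.le (sq_nonneg (‖z - w‖ - ‖c‖)),
    mul_nonneg (by linarith : 0 ≤ ρ - 7 * L) (sq_nonneg ‖c‖), mul_nonneg hL.le (sq_nonneg ‖c‖)]

theorem aux_opt {E : Type*} [NormedAddCommGroup E] [InnerProductSpace ℝ E]
    {K : ℕ} (g : Fin K → E → ℝ) (h : E → ℝ) (ρ : Fin K → ℝ) (X : Set E)
    (hh : ConvexOn ℝ Set.univ h) (hXcv : Convex ℝ X) (p y : Fin K → E) (z : E) (hz : z ∈ X)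
    (hmin : ∀ u ∈ X, augL g h ρ p z y ≤ augL g h ρ p u y) :
    (∀ u, augL g h ρ p u y - augL g h ρ p z y =
      h u - h z + (∑ k, ⟪- y k - ρ k • (p k - z), u - z⟫) + ∑ k, ρ k / 2 * ‖u - z‖ ^ 2) ∧
    ∀ u ∈ X, 0 ≤ h u - h z + ∑ k, ⟪- y k - ρ k • (p k - z), u - z⟫ := by
  have key : ∀ u, augL g h ρ p u y - augL g h ρ p z y =
      h u - h z + (∑ k, ⟪- y k - ρ k • (p k - z), u - z⟫) + ∑ k, ρ k / 2 * ‖u - z‖ ^ 2 := by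
    intro u
    have : ∀ k, ⟪- y k - ρ k • (p k - z), u - z⟫ + ρ k / 2 * ‖u - z‖ ^ 2
        = (⟪y k, p k - u⟫ + ρ k / 2 * ‖p k - u‖ ^ 2)
          - (⟪y k, p k - z⟫ + ρ k / 2 * ‖p k - z‖ ^ 2) := by
      intro k
      have e : p k - u = (p k - z) - (u - z) := by abel
      rw [e, norm_sub_sq_real (p k - z) (u - z), inner_sub_right (y k), inner_sub_left, inner_neg_left,
        real_inner_smul_left]
      ring
    have h3 := Finset.sum_congr rfl (fun k (_ : k ∈ Finset.univ) => this k)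
    rw [Finset.sum_sub_distrib, Finset.sum_add_distrib, Finset.sum_add_distrib,
      Finset.sum_add_distrib] at h3
    unfold augL
    linarith
  refine ⟨key, fun u hu => ?_⟩
  set A := h u - h z + ∑ k, ⟪- y k - ρ k • (p k - z), u - z⟫ with hA
  set B := ∑ k, ρ k / 2 * ‖u - z‖ ^ 2 with hB
  have hs : ∀ s : ℝ, 0 < s → s ≤ 1 → 0 ≤ A + s * B := by
    intro s hs0 hs1
    have hmem : z + s • (u - z) ∈ X := hXcv.add_smul_sub_mem hz hu ⟨hs0.le, hs1⟩
    have h1 := hmin _ hmem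
    have h2 := key (z + s • (u - z))
    have h3 : h (z + s • (u - z)) ≤ h z + s * (h u - h z) := by
      have := hh.2 (Set.mem_univ z) (Set.mem_univ u) (sub_nonneg.2 hs1) hs0.le (by ring)
      have e : (1 - s) • z + s • u = z + s • (u - z) := by
        rw [sub_smul, one_smul, smul_sub]; abel
      rw [e] at this
      simp only [smul_eq_mul] at this
      linarith
    simp only [add_sub_cancel_left, real_inner_smul_right, norm_smul, mul_pow, Real.norm_eq_abs,
      sq_abs] at h2
    rw [← Finset.mul_sum] at h2
    have e4 : ∑ k, ρ k / 2 * (s ^ 2 * ‖u - z‖ ^ 2) = s ^ 2 * B := by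
      rw [hB, Finset.mul_sum]; exact Finset.sum_congr rfl fun k _ => by ring
    rw [e4] at h2
    have : 0 ≤ s * (A + s * B) := by rw [hA]; nlinarith
    exact nonneg_of_mul_nonneg_right this hs0
  have hlim : Tendsto (fun s : ℝ => A + s * B) (𝓝[>] 0) (𝓝 (A + 0 * B)) := by
    apply Tendsto.mono_left _ nhdsWithin_le_nhds
    exact (Continuous.tendsto (by fun_prop) 0)
  rw [zero_mul, add_zero] at hlim
  refine ge_of_tendsto hlim ?_
  filter_upwards [Ioc_mem_nhdsGT (zero_lt_one (α := ℝ))] with s hs'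
  exact hs s hs'.1 hs'.2

theorem aux_dist {E : Type*} [NormedAddCommGroup E] (x : ℕ → E) (n t p q : ℕ)
    (hpq : p ≤ q) (hq : q ≤ t + 1) (hp : t + 1 ≤ p + n) :
    ‖x q - x p‖ ^ 2 ≤ n * ∑ s ∈ Finset.Ico (t + 1 - n) (t + 1), ‖x (s + 1) - x s‖ ^ 2 := by
  have h1 : ‖x q - x p‖ ≤ ∑ s ∈ Finset.Ico (t + 1 - n) (t + 1), ‖x (s + 1) - x s‖ := by
    have := dist_le_Ico_sum_dist x hpq
    rw [dist_comm, dist_eq_norm] at this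
    refine this.trans ?_
    simp_rw [dist_comm (x _) (x (_ + 1)), dist_eq_norm]
    refine Finset.sum_le_sum_of_subset_of_nonneg ?_ (fun _ _ _ => norm_nonneg _)
    exact Finset.Ico_subset_Ico (by omega) hq
  calc ‖x q - x p‖ ^ 2 ≤ (∑ s ∈ Finset.Ico (t + 1 - n) (t + 1), ‖x (s + 1) - x s‖) ^ 2 := by
        gcongr
    _ ≤ _ := sq_sum_le_card_mul_sum_sq
    _ ≤ _ := by
        gcongr
        rw [Nat.card_Ico]; omega

theorem aux_window (δ : ℕ → ℝ) (hδ : ∀ s, 0 ≤ δ s) (n N : ℕ) :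
    ∑ t ∈ Finset.range N, ∑ s ∈ Finset.Ico (t + 1 - n) (t + 1), δ s
      ≤ n * ∑ s ∈ Finset.range N, δ s := by
  have : ∀ t ∈ Finset.range N, ∑ s ∈ Finset.Ico (t + 1 - n) (t + 1), δ s
      = ∑ s ∈ Finset.range N, if t + 1 - n ≤ s ∧ s < t + 1 then δ s else 0 := by
    intro t ht
    rw [← Finset.sum_filter]
    apply Finset.sum_congr _ (fun _ _ => rfl)
    ext s
    simp only [Finset.mem_Ico, Finset.mem_filter, Finset.mem_range] at *
    omega
  rw [Finset.sum_congr rfl this, Finset.sum_comm, Finset.mul_sum]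
  refine Finset.sum_le_sum fun s _ => ?_
  rw [← Finset.sum_filter, Finset.sum_const, nsmul_eq_mul]
  refine mul_le_mul_of_nonneg_right ?_ (hδ s)
  have : (Finset.range N).filter (fun t => t + 1 - n ≤ s ∧ s < t + 1) ⊆ Finset.Ico s (s + n) := by
    intro t
    simp only [Finset.mem_Ico, Finset.mem_filter, Finset.mem_range]
    omega
  have h2 := Finset.card_le_card this
  rw [Nat.card_Ico] at h2
  exact_mod_cast (by omega)

theorem aux_tele (V R : ℕ → ℝ) (hV : ∀ t, 1 ≤ t → V (t + 1) - V t ≤ R t) (N : ℕ) :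
    V (N + 1) ≤ ∑ t ∈ Finset.range (N + 1), R t + (V 1 - R 0) := by
  induction N with
  | zero => simp
  | succ n ih =>
    rw [Finset.sum_range_succ]
    have := hV (n + 1) (by omega)
    linarith

theorem aux_split {E : Type*} [NormedAddCommGroup E] [InnerProductSpace ℝ E]
    {K : ℕ} (g : Fin K → E → ℝ) (h : E → ℝ) (ρ : Fin K → ℝ) (p y : Fin K → E) (z : E) :
    augL g h ρ p z y = h z + ∑ k, (g k (p k) + ⟪y k, p k - z⟫ + ρ k / 2 * ‖p k - z‖ ^ 2) := by
  unfold augL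
  rw [Finset.sum_add_distrib, Finset.sum_add_distrib]
  ring

theorem aux_main {E : Type*} [NormedAddCommGroup E] [InnerProductSpace ℝ E] [CompleteSpace E]
    {K : ℕ} (g : Fin K → E → ℝ) (h : E → ℝ) (L ρ : Fin K → ℝ) (T : Fin K → ℕ)
    (X : Set E) (x : ℕ → E) (xk : Fin K → ℕ → E) (y : Fin K → ℕ → E) (τ : Fin K → ℕ → ℕ)
    (hL : ∀ k, 0 < L k) (hρ : ∀ k, 0 < ρ k)
    (hg : ∀ k, ContDiff ℝ 1 (g k))
    (hlip : ∀ k, ∀ u v : E, ‖gradient (g k) u - gradient (g k) v‖ ≤ L k * ‖u - v‖)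
    (hh : ConvexOn ℝ Set.univ h) (hhc : Continuous h)
    (hXcp : IsCompact X) (hXcv : Convex ℝ X)
    (hτ1 : ∀ k t, τ k t ≤ t) (hτ2 : ∀ k t, t ≤ τ k t + T k)
    (hxmem : ∀ t, x t ∈ X)
    (hxupd : ∀ t, ∀ u ∈ X,
      augL g h ρ (fun k => xk k t) (x (t + 1)) (fun k => y k t)
        ≤ augL g h ρ (fun k => xk k t) u (fun k => y k t))
    (hyy : ∀ k t, y k (t + 1) = - gradient (g k) (x (τ k (t + 1))))
    (hy : ∀ k t, y k (t + 1) = y k t + ρ k • (xk k (t + 1) - x (t + 1)))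
    (hstep1 : ∀ k, 7 * L k < ρ k)
    (hstep2 : ∀ k, 0 < ρ k - 2 * (1 / ρ k + 7 * L k / (2 * ρ k ^ 2)) * (L k) ^ 2
      * ((T k : ℝ) + 1) ^ 2 - L k * (T k : ℝ) ^ 2) (k₀ : Fin K) :
    Tendsto (fun t => ‖x (t + 1) - x t‖) atTop (𝓝 0) := by
  -- distance between the local and the global variables
  have ha : ∀ k t, 1 ≤ t → ‖xk k (t + 1) - x (t + 1)‖
      ≤ L k / ρ k * ‖x (τ k (t + 1)) - x (τ k t)‖ := by
    intro k t ht
    obtain ⟨s, rfl⟩ : ∃ s, t = s + 1 := ⟨t - 1, by omega⟩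
    have h1 : ρ k • (xk k (s + 1 + 1) - x (s + 1 + 1))
        = gradient (g k) (x (τ k (s + 1))) - gradient (g k) (x (τ k (s + 1 + 1))) := by
      have e1 := hy k (s + 1)
      rw [hyy k (s + 1), hyy k s] at e1
      have e2 := eq_sub_of_add_eq' e1.symm
      rw [e2]; abel
    have h2 := hlip k (x (τ k (s + 1))) (x (τ k (s + 1 + 1)))
    rw [← h1, norm_smul, Real.norm_of_nonneg (hρ k).le, norm_sub_rev (x _)] at h2
    rw [div_mul_eq_mul_div, le_div_iff₀ (hρ k)]
    linarith
  set δ : ℕ → ℝ := fun s => ‖x (s + 1) - x s‖ ^ 2 with hδ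
  have hδ0 : ∀ s, 0 ≤ δ s := fun s => by positivity
  set W : ℕ → ℕ → ℝ := fun n t => ∑ s ∈ Finset.Ico (t + 1 - n) (t + 1), δ s with hW
  set V : ℕ → ℝ := fun t => augL g h ρ (fun k => xk k t) (x t) (fun k => y k t) with hV
  set A : Fin K → ℝ := fun k => (ρ k + L k / 2) * (L k / ρ k) ^ 2 * ((T k + 1 : ℕ) : ℝ) with hA
  set B : Fin K → ℝ := fun k => L k / 2 * (T k : ℝ) with hB
  set R : ℕ → ℝ := fun t => ∑ k, (A k * W (T k + 1) t + B k * W (T k) t - ρ k / 2 * δ t) with hR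
  have hstep : ∀ t, 1 ≤ t → V (t + 1) - V t ≤ R t := by
    intro t ht
    have hopt := aux_opt g h ρ X hh hXcv (fun k => xk k t) (fun k => y k t) (x (t + 1))
      (hxmem _) (hxupd t)
    have h1 := hopt.1 (x t)
    have h2 := hopt.2 (x t) (hxmem t)
    rw [norm_sub_rev] at h1
    have h3 : V (t + 1) - augL g h ρ (fun k => xk k t) (x (t + 1)) (fun k => y k t)
        ≤ ∑ k, (A k * W (T k + 1) t + B k * W (T k) t) := by
      simp only [hV]
      rw [aux_split, aux_split, add_sub_add_left_eq_sub, ← Finset.sum_sub_distrib]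
      refine Finset.sum_le_sum fun k _ => ?_
      refine (aux_kstep (g k) (L k) (ρ k) (hL k) (hstep1 k) (hg k) (hlip k) _ _ _
        (x (τ k (t + 1))) _ _ (hy k t) (hyy k t)).trans ?_
      have e1 : ‖xk k (t + 1) - x (t + 1)‖ ^ 2
          ≤ (L k / ρ k) ^ 2 * (((T k + 1 : ℕ) : ℝ) * W (T k + 1) t) := by
        have i1 : ‖x (τ k (t + 1)) - x (τ k t)‖ ^ 2 ≤ ((T k + 1 : ℕ) : ℝ) * W (T k + 1) t := by
          have j1 := hτ1 k (t + 1)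
          have j2 := hτ1 k t
          have j3 := hτ2 k (t + 1)
          have j4 := hτ2 k t
          rcases le_total (τ k t) (τ k (t + 1)) with hle | hle
          · exact aux_dist x (T k + 1) t _ _ hle (by omega) (by omega)
          · rw [norm_sub_rev]
            exact aux_dist x (T k + 1) t _ _ hle (by omega) (by omega)
        calc _ ≤ (L k / ρ k * ‖x (τ k (t + 1)) - x (τ k t)‖) ^ 2 := by
              gcongr; exact ha k t ht
          _ = (L k / ρ k) ^ 2 * ‖x (τ k (t + 1)) - x (τ k t)‖ ^ 2 := by ring
          _ ≤ _ := by gcongr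
      have e2 : ‖x (t + 1) - x (τ k (t + 1))‖ ^ 2 ≤ (T k : ℝ) * W (T k) t :=
        aux_dist x (T k) t _ _ (hτ1 k _) le_rfl (hτ2 k _)
      have hLk := hL k
      have hρk := hρ k
      calc _ ≤ (ρ k + L k / 2) * ((L k / ρ k) ^ 2 * (((T k + 1 : ℕ) : ℝ) * W (T k + 1) t))
            + L k / 2 * ((T k : ℝ) * W (T k) t) := by gcongr
        _ = _ := by simp only [hA, hB]; ring
    have h4 : R t = ∑ k, (A k * W (T k + 1) t + B k * W (T k) t) - ∑ k, ρ k / 2 * δ t := by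
      rw [← Finset.sum_sub_distrib]
    simp only [hδ] at h4
    simp only [hV] at h3 ⊢
    linarith
  -- lower bound
  obtain ⟨m, hm⟩ : ∃ m, ∀ t, m ≤ V (t + 2) := by
    obtain ⟨M, hM⟩ := hXcp.isBounded.exists_norm_le
    have hM2 : ∀ s t, ‖x s - x t‖ ≤ 2 * M := fun s t =>
      (norm_sub_le _ _).trans (by linarith [hM _ (hxmem s), hM _ (hxmem t)])
    have hM0 : 0 ≤ 2 * M := (norm_nonneg _).trans (hM2 0 0)
    have hb : ∀ f : E → ℝ, Continuous f → ∃ c, ∀ t, c ≤ f (x t) := by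
      intro f hf
      obtain ⟨c, hc⟩ := (hXcp.image hf).bddBelow
      exact ⟨c, fun t => hc ⟨_, hxmem t, rfl⟩⟩
    obtain ⟨c, hc⟩ := hb h hhc
    choose c' hc' using fun k => hb (g k) (hg k).continuous
    refine ⟨c + ∑ k, (c' k - L k * (2 * M) * (L k / ρ k * (2 * M))), fun t => ?_⟩
    simp only [hV]
    rw [aux_split]
    refine add_le_add (hc _) (Finset.sum_le_sum fun k _ => ?_)
    have hLk := hL k
    have hρk := hρ k
    have d := (abs_le.1 (aux_descent (g k) (L k) hLk (hg k) (hlip k) (x (t + 2)) (xk k (t + 2)))).1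
    have n1 : ‖xk k (t + 2) - x (t + 2)‖ ≤ L k / ρ k * (2 * M) := by
      refine (ha k (t + 1) (by omega)).trans ?_
      gcongr
      exact hM2 _ _
    have n2 : -(⟪gradient (g k) (x (t + 2)), xk k (t + 2) - x (t + 2)⟫
        + ⟪y k (t + 2), xk k (t + 2) - x (t + 2)⟫) ≤ L k * (2 * M) * (L k / ρ k * (2 * M)) := by
      rw [← inner_add_left, ← inner_neg_left]
      refine (real_inner_le_norm _ _).trans ?_
      rw [norm_neg, hyy k (t + 1), ← sub_eq_add_neg]
      gcongr
      refine (hlip k _ _).trans ?_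
      gcongr
      exact hM2 _ _
    have n3 := hc' k (t + 2)
    nlinarith [mul_nonneg (by linarith [hstep1 k] : 0 ≤ ρ k / 2 - L k)
      (sq_nonneg ‖xk k (t + 2) - x (t + 2)‖)]
  -- the total coefficient
  set C : ℝ := ∑ k, (ρ k / 2 - A k * ((T k + 1 : ℕ) : ℝ) - B k * (T k : ℝ)) with hC
  have hCpos : 0 < C := by
    refine Finset.sum_pos (fun k _ => ?_) ⟨k₀, Finset.mem_univ _⟩
    have h1 := hstep2 k
    have hLk := hL k
    have hρk := hρ k
    have e : A k * ((T k + 1 : ℕ) : ℝ) + 3 * L k / ρ k ^ 2 * L k ^ 2 * ((T k : ℝ) + 1) ^ 2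
        = (1 / ρ k + 7 * L k / (2 * ρ k ^ 2)) * (L k) ^ 2 * ((T k : ℝ) + 1) ^ 2 := by
      simp only [hA]
      push_cast
      field_simp
      ring
    have e2 : 0 ≤ 3 * L k / ρ k ^ 2 * L k ^ 2 * ((T k : ℝ) + 1) ^ 2 := by positivity
    simp only [hB]
    nlinarith
  have hsumR : ∀ N, ∑ t ∈ Finset.range N, R t ≤ - (C * ∑ s ∈ Finset.range N, δ s) := by
    intro N
    simp only [hR, hC]
    rw [Finset.sum_comm, Finset.sum_mul, ← Finset.sum_neg_distrib]
    refine Finset.sum_le_sum fun k _ => ?_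
    rw [Finset.sum_sub_distrib, Finset.sum_add_distrib, ← Finset.mul_sum, ← Finset.mul_sum,
      ← Finset.mul_sum]
    have hLk := hL k
    have hρk := hρ k
    have w1 := mul_le_mul_of_nonneg_left (aux_window δ hδ0 (T k + 1) N)
      (by simp only [hA]; positivity : 0 ≤ A k)
    have w2 := mul_le_mul_of_nonneg_left (aux_window δ hδ0 (T k) N)
      (by simp only [hB]; positivity : 0 ≤ B k)
    simp only [hW]
    linarith
  have hsummable : Summable δ := by
    refine summable_of_sum_range_le (c := (V 1 - R 0 - m) / C) hδ0 fun N => ?_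
    rw [le_div_iff₀ hCpos]
    have h1 := aux_tele V R hstep (N + 1)
    have h2 := hsumR (N + 1 + 1)
    have h3 := hm N
    have h4 : ∑ s ∈ Finset.range N, δ s ≤ ∑ s ∈ Finset.range (N + 1 + 1), δ s :=
      Finset.sum_le_sum_of_subset_of_nonneg (Finset.range_subset_range.2 (by omega))
        (fun s _ _ => hδ0 s)
    nlinarith
  have h0 := hsummable.tendsto_atTop_zero.sqrt
  simpa [hδ] using h0

theorem aux_delay {E : Type*} [NormedAddCommGroup E] (x : ℕ → E)
    (hd : Tendsto (fun t => ‖x (t + 1) - x t‖) atTop (𝓝 0)) (T : ℕ) (τ : ℕ → ℕ)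
    (hτ1 : ∀ t, τ t ≤ t) (hτ2 : ∀ t, t ≤ τ t + T) :
    Tendsto (fun t => x (τ t) - x t) atTop (𝓝 0) := by
  rw [← tendsto_add_atTop_iff_nat 1]
  rw [Metric.tendsto_atTop] at hd ⊢
  intro ε hε
  obtain ⟨N, hN⟩ := hd (ε / (T + 1)) (by positivity)
  refine ⟨N + T, fun t ht => ?_⟩
  have h1 := aux_dist x T t _ _ (hτ1 (t + 1)) le_rfl (hτ2 (t + 1))
  have h2 : ∑ s ∈ Finset.Ico (t + 1 - T) (t + 1), ‖x (s + 1) - x s‖ ^ 2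
      ≤ T * (ε / (T + 1)) ^ 2 := by
    calc _ ≤ (Finset.Ico (t + 1 - T) (t + 1)).card • (ε / (T + 1)) ^ 2 := by
          refine Finset.sum_le_card_nsmul _ _ _ fun s hs => ?_
          rw [Finset.mem_Ico] at hs
          have := hN s (by omega)
          rw [Real.dist_0_eq_abs, abs_norm] at this
          gcongr
      _ ≤ _ := by
          rw [nsmul_eq_mul]
          gcongr
          rw [Nat.card_Ico]; omega
  rw [dist_zero_right, norm_sub_rev]
  refine lt_of_pow_lt_pow_left₀ 2 hε.le ?_
  calc _ ≤ _ := h1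
    _ ≤ T * (T * (ε / (T + 1)) ^ 2) := by gcongr
    _ = (T / (T + 1)) ^ 2 * ε ^ 2 := by ring
    _ < 1 * ε ^ 2 := by
        gcongr
        rw [sq_lt_one_iff₀ (by positivity), div_lt_one (by positivity)]
        linarith
    _ = _ := one_mul _

/-- (Theorem 3.1, part 2) Under the Async-PADMM update rules with Assumption A3,
every limit point `(x*, {x_k*}, {y_k*})` of the iterates satisfies `x_k* = x*`,
`y_k* = −∇g_k(x*)`, and `x*` is a stationary point of `min_{x∈X} f(x)`. -/
theorem stmt_12 {E : Type*} [NormedAddCommGroup E] [InnerProductSpace ℝ E] [CompleteSpace E]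
    {K : ℕ} (g : Fin K → E → ℝ) (h : E → ℝ) (L ρ : Fin K → ℝ) (T : Fin K → ℕ)
    (X : Set E) (x : ℕ → E) (xk : Fin K → ℕ → E) (y : Fin K → ℕ → E) (τ : Fin K → ℕ → ℕ)
    (hL : ∀ k, 0 < L k) (hρ : ∀ k, 0 < ρ k)
    (hg : ∀ k, ContDiff ℝ 1 (g k))
    (hlip : ∀ k, ∀ u v : E, ‖gradient (g k) u - gradient (g k) v‖ ≤ L k * ‖u - v‖)
    (hh : ConvexOn ℝ Set.univ h) (hhc : Continuous h)
    (hXne : X.Nonempty) (hXcp : IsCompact X) (hXcv : Convex ℝ X)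
    (hbdd : BddBelow ((fun u => (∑ k, g k u) + h u) '' X))
    (hτ1 : ∀ k t, τ k t ≤ t) (hτ2 : ∀ k t, t ≤ τ k t + T k)
    (hxmem : ∀ t, x t ∈ X)
    (hxupd : ∀ t, ∀ u ∈ X,
      augL g h ρ (fun k => xk k t) (x (t + 1)) (fun k => y k t)
        ≤ augL g h ρ (fun k => xk k t) u (fun k => y k t))
    (hxk : ∀ k t, xk k (t + 1)
      = x (t + 1) - (ρ k)⁻¹ • (gradient (g k) (x (τ k (t + 1))) + y k t))
    (hy : ∀ k t, y k (t + 1) = y k t + ρ k • (xk k (t + 1) - x (t + 1)))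
    (hstep1 : ∀ k, 7 * L k < ρ k)
    (hstep2 : ∀ k, 0 < ρ k - 2 * (1 / ρ k + 7 * L k / (2 * ρ k ^ 2)) * (L k) ^ 2
      * ((T k : ℝ) + 1) ^ 2 - L k * (T k : ℝ) ^ 2)
    -- limit point along a subsequence
    (xstar : E) (xkstar : Fin K → E) (ystar : Fin K → E)
    (φ : ℕ → ℕ) (hφ : StrictMono φ)
    (hxlim : Tendsto (fun j => x (φ j)) atTop (𝓝 xstar))
    (hxklim : ∀ k, Tendsto (fun j => xk k (φ j)) atTop (𝓝 (xkstar k)))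
    (hylim : ∀ k, Tendsto (fun j => y k (φ j)) atTop (𝓝 (ystar k))) :
    (∀ k, xkstar k = xstar)
    ∧ (∀ k, ystar k = -gradient (g k) xstar)
    ∧ (∀ u ∈ X, ⟪∑ k, gradient (g k) xstar, u - xstar⟫ + h u - h xstar ≥ 0) := by
  have hyy : ∀ k t, y k (t + 1) = - gradient (g k) (x (τ k (t + 1))) := by
    intro k t
    rw [hy, hxk, sub_sub_cancel_left, smul_neg, smul_inv_smul₀ (hρ k).ne']
    abel
  have hd : Fin K → Tendsto (fun t => ‖x (t + 1) - x t‖) atTop (𝓝 0) := fun k₀ =>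
    aux_main g h L ρ T X x xk y τ hL hρ hg hlip hh hhc hXcp hXcv hτ1 hτ2 hxmem hxupd hyy hy
      hstep1 hstep2 k₀
  have hgc : ∀ k, Continuous (gradient (g k)) := fun k => by
    refine LipschitzWith.continuous (K := ⟨L k, (hL k).le⟩) ?_
    refine LipschitzWith.of_dist_le_mul fun u v => ?_
    rw [dist_eq_norm, dist_eq_norm]
    exact hlip k u v
  -- along any subsequence where `x` converges to `xstar`
  have hsub : ∀ k, ∀ ψ : ℕ → ℕ, Tendsto ψ atTop atTop →
      Tendsto (fun j => x (ψ j)) atTop (𝓝 xstar) →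
      Tendsto (fun j => y k (ψ j)) atTop (𝓝 (- gradient (g k) xstar)) := by
    intro k ψ hψ hx
    have h1 := (aux_delay x (hd k) (T k) (τ k) (hτ1 k) (hτ2 k)).comp hψ
    have h2 : Tendsto (fun j => x (τ k (ψ j))) atTop (𝓝 xstar) := by
      simpa using h1.add hx
    refine (((hgc k).tendsto xstar).comp h2).neg.congr' ?_
    filter_upwards [hψ.eventually_ge_atTop 1] with j hj
    obtain ⟨s, hs⟩ : ∃ s, ψ j = s + 1 := ⟨ψ j - 1, by omega⟩
    simp only [Function.comp, hs, hyy]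
  have hprev : Fin K → ∀ ψ : ℕ → ℕ, Tendsto ψ atTop atTop →
      Tendsto (fun j => x (ψ j)) atTop (𝓝 xstar) →
      Tendsto (fun j => x (ψ j - 1)) atTop (𝓝 xstar) := by
    intro k ψ hψ hx
    have h1 := (aux_delay x (hd k) 1 (fun t => t - 1) (by intro t; simp)
      (by intro t; omega)).comp hψ
    simpa using h1.add hx
  have hpred : ∀ ψ : ℕ → ℕ, Tendsto ψ atTop atTop → Tendsto (fun j => ψ j - 1) atTop atTop :=
    fun ψ hψ => (tendsto_sub_atTop_nat 1).comp hψ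
  have hsubk : ∀ k, ∀ ψ : ℕ → ℕ, Tendsto ψ atTop atTop →
      Tendsto (fun j => x (ψ j)) atTop (𝓝 xstar) →
      Tendsto (fun j => xk k (ψ j)) atTop (𝓝 xstar) := by
    intro k ψ hψ hx
    have h1 := hsub k ψ hψ hx
    have h2 := hsub k (fun j => ψ j - 1) (hpred ψ hψ) (hprev k ψ hψ hx)
    have h3 := hx.add ((h1.sub h2).const_smul (ρ k)⁻¹)
    rw [sub_self, smul_zero, add_zero] at h3
    refine h3.congr' ?_
    filter_upwards [hψ.eventually_ge_atTop 1] with j hj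
    obtain ⟨s, hs⟩ : ∃ s, ψ j = s + 1 := ⟨ψ j - 1, by omega⟩
    simp only [hs, Nat.add_sub_cancel]
    rw [hy k s, add_sub_cancel_left, inv_smul_smul₀ (hρ k).ne']
    abel
  have hφt := hφ.tendsto_atTop
  refine ⟨fun k => tendsto_nhds_unique (hxklim k) (hsubk k φ hφt hxlim),
    fun k => tendsto_nhds_unique (hylim k) (hsub k φ hφt hxlim), fun u hu => ?_⟩
  have hlim : Tendsto (fun j => h u - h (x (φ j))
      + ∑ k, ⟪- y k (φ j - 1) - ρ k • (xk k (φ j - 1) - x (φ j)), u - x (φ j)⟫) atTop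
      (𝓝 (h u - h xstar
        + ∑ k, ⟪- (- gradient (g k) xstar) - ρ k • (xstar - xstar), u - xstar⟫)) := by
    refine (tendsto_const_nhds.sub ((hhc.tendsto xstar).comp hxlim)).add ?_
    refine tendsto_finsetSum _ fun k _ => ?_
    have h2 := hsub k (fun j => φ j - 1) (hpred φ hφt) (hprev k φ hφt hxlim)
    have h3 := hsubk k (fun j => φ j - 1) (hpred φ hφt) (hprev k φ hφt hxlim)
    exact (h2.neg.sub ((h3.sub hxlim).const_smul (ρ k))).inner (tendsto_const_nhds.sub hxlim)
  have hge := ge_of_tendsto hlim (b := 0) (by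
    filter_upwards [hφt.eventually_ge_atTop 1] with j hj
    obtain ⟨s, hs⟩ : ∃ s, φ j = s + 1 := ⟨φ j - 1, by omega⟩
    simp only [hs, Nat.add_sub_cancel]
    exact (aux_opt g h ρ X hh hXcv (fun k => xk k s) (fun k => y k s) (x (s + 1))
      (hxmem _) (hxupd s)).2 u hu)
  simp only [neg_neg, sub_self, smul_zero, sub_zero] at hge
  rw [sum_inner]
  linarith
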